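/- arXiv:math/0609503 — 8 statements merged into one kernel-verified Lean document; each statement's English description precedes it below -/
import Mathlib

section
/- Let π : X → Y be a continuous surjection between compact Hausdorff spaces. Then π is semiopen if and only if the preimage under π of every dense subset of Y is dense in X. -/
/-- A continuous surjection between compact Hausdorff spaces is semiopen
(the image of every nonempty open set has nonempty interior) if and only if
the preimage of every dense subset of `Y` is dense in `X`. -/
theorem semiopen_iff_preimage_dense {X Y : Type*}
    [TopologicalSpace X] [TopologicalSpace Y]
    [CompactSpace X] [T2Space X] [CompactSpace Y] [T2Space Y]
    (π : X → Y) (hcont : Continuous π) (hsurj : Function.Surjective π) :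
    (∀ U : Set X, IsOpen U → U.Nonempty → (interior (π '' U)).Nonempty) ↔
      (∀ D : Set Y, Dense D → Dense (π ⁻¹' D)) := by
  constructor
  · intro h D hD
    rw [dense_iff_inter_open]
    intro U hU hne
    obtain ⟨y, hy, hyD⟩ := hD.inter_open_nonempty _ isOpen_interior (h U hU hne)
    obtain ⟨x, hx, rfl⟩ := interior_subset hy
    exact ⟨x, hx, hyD⟩
  · intro h U hU hne
    by_contra hempty
    rw [Set.not_nonempty_iff_eq_empty, interior_eq_empty_iff_dense_compl] at hempty
    obtain ⟨x, hx, hxD⟩ := (h _ hempty).inter_open_nonempty U hU hne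
    exact hxD (Set.mem_image_of_mem π hx)
end

section
/- Let π : X → Y be a continuous surjection between compact metric spaces, and let F : Y → K(X) be its fiber map, F(y) = π⁻¹({y}). Then π is semiopen if and only if the set X₀ = {x ∈ X : F is continuous at π(x)} is dense in X. -/
open Set Filter Topology TopologicalSpace

/-- A map into the nonempty compact subsets is continuous at a point iff it is both upper and lower
hemicontinuous there. -/
theorem continuousAt_nonemptyCompacts_iff {X Y : Type*} [TopologicalSpace X] [TopologicalSpace Y]
    {F : Y → NonemptyCompacts X} {y : Y} :
    ContinuousAt F y ↔ UpperHemicontinuousAt (fun z => (F z : Set X)) y ∧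
      LowerHemicontinuousAt (fun z => (F z : Set X)) y := by
  let _ := TopologicalSpace.vietoris X
  rw [NonemptyCompacts.isEmbedding_coe.isInducing.continuousAt_iff, ContinuousAt,
    tendsto_nhds_generateFrom_iff, upperHemicontinuousAt_iff_forall_isOpen,
    lowerHemicontinuousAt_iff]
  constructor
  · exact fun h => ⟨fun U hU hyU => h _ (.inl ⟨U, hU, rfl⟩) hyU,
      fun U hU hyU => h _ (.inr ⟨U, hU, rfl⟩) hyU⟩
  · rintro ⟨h₁, h₂⟩ _ (⟨U, hU, rfl⟩ | ⟨U, hU, rfl⟩) hy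
    exacts [h₁ U hU hy, h₂ U hU hy]

/-- The preimage of a closed set with empty interior under a semiopen map has empty interior. -/
theorem interior_preimage_eq_empty_of_semiopen {X Y : Type*} [TopologicalSpace X]
    [TopologicalSpace Y] {f : X → Y}
    (hf : ∀ U : Set X, IsOpen U → U.Nonempty → (interior (f '' U)).Nonempty)
    {s : Set Y} (hs : interior s = ∅) : interior (f ⁻¹' s) = ∅ := by
  by_contra! h
  obtain ⟨y, hy⟩ := hf _ isOpen_interior h
  have : y ∈ interior s := interior_mono (image_subset_iff.2 interior_subset) hy
  simp [hs] at this

/-- The fibers of a map are lower hemicontinuous at every point lying on no frontier of the image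
of the closure of a basic open set. -/
theorem lowerHemicontinuousAt_fiber_of_notMem_frontier {X Y : Type*} [TopologicalSpace X]
    [RegularSpace X] [TopologicalSpace Y] {f : X → Y} {B : Set (Set X)}
    (hB : IsTopologicalBasis B) {y : Y} (hy : ∀ V ∈ B, y ∉ frontier (f '' closure V)) :
    LowerHemicontinuousAt (fun z => f ⁻¹' {z}) y := by
  rw [lowerHemicontinuousAt_iff]
  rintro U hU ⟨x, rfl, hxU⟩
  obtain ⟨V, hVB, hxV, hVU⟩ := hB.exists_closure_subset (hU.mem_nhds hxU)
  have hmem : f x ∈ f '' closure V := mem_image_of_mem f (subset_closure hxV)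
  have hint : f x ∈ interior (f '' closure V) := by
    by_contra h
    exact hy V hVB ⟨subset_closure hmem, h⟩
  filter_upwards [mem_interior_iff_mem_nhds.1 hint]
  rintro _ ⟨x', hx', rfl⟩
  exact ⟨x', rfl, hVU hx'⟩


/-- For a continuous surjection `π : X → Y` between compact metric spaces, with
fiber map `F : Y → K(X)`, `F y = π⁻¹ {y}` (into the space of nonempty compact
subsets of `X` with the Hausdorff metric), `π` is semiopen iff the set
`X₀ = {x : F is continuous at π x}` is dense in `X`. -/
theorem semiopen_iff_dense_continuityPoints_fiberMap {X Y : Type*}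
    [MetricSpace X] [CompactSpace X] [MetricSpace Y] [CompactSpace Y]
    (π : X → Y) (hcont : Continuous π) (hsurj : Function.Surjective π)
    (F : Y → TopologicalSpace.NonemptyCompacts X)
    (hF : ∀ y : Y, (F y : Set X) = π ⁻¹' {y}) :
    (∀ U : Set X, IsOpen U → U.Nonempty → (interior (π '' U)).Nonempty) ↔
      Dense {x : X | ContinuousAt F (π x)} := by
  have hfib : (fun z => (F z : Set X)) = fun z => π ⁻¹' {z} := funext hF
  simp_rw [continuousAt_nonemptyCompacts_iff, hfib]
  constructor
  · intro hsemi
    obtain ⟨B, hBc, -, hB⟩ := exists_countable_basis X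
    have hupper := isClosedMap_iff_upperHemicontinuous.1 hcont.isClosedMap
    have hdense : Dense (⋂ V ∈ B, (π ⁻¹' frontier (π '' closure V))ᶜ) := by
      refine dense_biInter_of_isOpen
        (fun V _ => (isClosed_frontier.preimage hcont).isOpen_compl) hBc fun V _ => ?_
      rw [← interior_eq_empty_iff_dense_compl]
      exact interior_preimage_eq_empty_of_semiopen hsemi
        (interior_frontier (hcont.isClosedMap _ isClosed_closure))
    refine hdense.mono fun x hx => ⟨hupper.upperHemicontinuousAt _, ?_⟩
    exact lowerHemicontinuousAt_fiber_of_notMem_frontier hB (by simpa using hx)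
  · intro hdense U hU hne
    obtain ⟨x, hxU, -, hx⟩ := hdense.inter_open_nonempty U hU hne
    refine ⟨π x, mem_interior_iff_mem_nhds.2 ?_⟩
    filter_upwards [lowerHemicontinuousAt_iff.1 hx U hU ⟨x, rfl, hxU⟩]
    rintro _ ⟨x', rfl, hx'⟩
    exact mem_image_of_mem π hx'
end

section
/- Let π : X → Y be a continuous surjection between compact metric spaces, and let F : Y → K(X) be its fiber map, F(y) = π⁻¹({y}). Then the set Y₀ = {y ∈ Y : F is continuous at y} is a dense Gδ subset of Y. -/
open Set Filter Topology TopologicalSpace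

/-- A map into the nonempty compact subsets is continuous at a point as soon as it is upper and
lower hemicontinuous there. -/
theorem TopologicalSpace.NonemptyCompacts.continuousAt_of_hemicontinuousAt {X Y : Type*}
    [TopologicalSpace X] [TopologicalSpace Y] {F : Y → NonemptyCompacts X} {y : Y}
    (hu : UpperHemicontinuousAt (fun z => (F z : Set X)) y)
    (hl : LowerHemicontinuousAt (fun z => (F z : Set X)) y) : ContinuousAt F y := by
  let := TopologicalSpace.vietoris X
  have hemb : IsEmbedding ((↑) : NonemptyCompacts X → Set X) := NonemptyCompacts.isEmbedding_coe
  rw [hemb.continuousAt_iff]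
  refine tendsto_nhds_generateFrom_iff.2 ?_
  rintro _ (⟨U, hU, rfl⟩ | ⟨U, hU, rfl⟩) hy
  · exact upperHemicontinuousAt_iff_forall_isOpen.1 hu U hU hy
  · exact lowerHemicontinuousAt_iff.1 hl U hU hy

/-- The fibers of a closed map from a regular second countable space to a Baire space are lower
hemicontinuous on a dense set. -/
theorem IsClosedMap.dense_setOf_lowerHemicontinuousAt {X Y : Type*}
    [TopologicalSpace X] [RegularSpace X] [SecondCountableTopology X]
    [TopologicalSpace Y] [BaireSpace Y] {f : X → Y} (hf : IsClosedMap f) :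
    Dense {y | LowerHemicontinuousAt (fun z => f ⁻¹' {z}) y} := by
  have hclosed (U : Set X) : IsClosed (f '' closure U) := hf _ isClosed_closure
  have hdense : Dense (⋂ U ∈ countableBasis X, (frontier (f '' closure U))ᶜ) :=
    dense_biInter_of_isOpen (fun U _ => isClosed_frontier.isOpen_compl) (countable_countableBasis X)
      fun U _ => interior_eq_empty_iff_dense_compl.1 (interior_frontier (hclosed U))
  refine hdense.mono fun y hy => mem_ofPred.2 (lowerHemicontinuousAt_iff.2 ?_)
  rintro V hV ⟨x, rfl, hxV⟩
  obtain ⟨U, hU, hxU, hUV⟩ :=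
    (isBasis_countableBasis X).exists_closure_subset (hV.mem_nhds hxV)
  have hint : f x ∈ interior (f '' closure U) := by
    by_contra h
    refine mem_iInter₂.1 hy U hU ?_
    rw [(hclosed U).frontier_eq]
    exact ⟨mem_image_of_mem f (subset_closure hxU), h⟩
  filter_upwards [mem_interior_iff_mem_nhds.1 hint]
  rintro _ ⟨x', hx', rfl⟩
  exact ⟨x', rfl, hUV hx'⟩

/-- For a continuous surjection `π : X → Y` between compact metric spaces, with
fiber map `F : Y → K(X)`, `F y = π⁻¹ {y}` (into the space of nonempty compact
subsets of `X` with the Hausdorff metric), the set of continuity points of `F`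
is a dense Gδ subset of `Y`. -/
theorem continuityPoints_fiberMap_dense_Gdelta {X Y : Type*}
    [MetricSpace X] [CompactSpace X] [MetricSpace Y] [CompactSpace Y]
    (π : X → Y) (hcont : Continuous π) (hsurj : Function.Surjective π)
    (F : Y → TopologicalSpace.NonemptyCompacts X)
    (hF : ∀ y : Y, (F y : Set X) = π ⁻¹' {y}) :
    Dense {y : Y | ContinuousAt F y} ∧ IsGδ {y : Y | ContinuousAt F y} := by
  refine ⟨?_, .setOfPred_continuousAt F⟩
  have hF' : (fun z => (F z : Set X)) = fun z => π ⁻¹' {z} := funext hF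
  have hclosed : IsClosedMap π := hcont.isClosedMap
  refine hclosed.dense_setOf_lowerHemicontinuousAt.mono fun y hy => ?_
  apply NonemptyCompacts.continuousAt_of_hemicontinuousAt
  · rw [hF']
    exact isClosedMap_iff_upperHemicontinuous.1 hclosed y
  · rwa [hF']
end

section
/- Let π : X → Y be a continuous surjection between compact metric spaces which is semiopen. Then the induced pushforward map π_* : M(X) → M(Y) between the spaces of Borel probability measures, equipped with the weak* topology, is a semiopen (continuous) surjection. -/
open MeasureTheory

open Filter Topology BoundedContinuousFunction

section FiniteDirac

variable {X ι : Type*} [MeasurableSpace X] [Fintype ι]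

/-- The probability measure with weight `w i` at the point `p i`. -/
noncomputable def finiteDirac (w : ι → ℝ) (hw : w ∈ stdSimplex ℝ ι) (p : ι → X) :
    ProbabilityMeasure X :=
  ⟨∑ i, ENNReal.ofReal (w i) • Measure.dirac (p i), ⟨by
    simp only [Measure.coe_finsetSum, Measure.coe_smul, Finset.sum_apply, Pi.smul_apply,
      measure_univ, smul_eq_mul, mul_one]
    rw [← ENNReal.ofReal_sum_of_nonneg fun i _ => hw.1 i, hw.2, ENNReal.ofReal_one]⟩⟩

lemma integral_finiteDirac [TopologicalSpace X] [OpensMeasurableSpace X]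
    (w : ι → ℝ) (hw : w ∈ stdSimplex ℝ ι) (p : ι → X) (f : X →ᵇ ℝ) :
    ∫ x, f x ∂(finiteDirac w hw p : Measure X) = ∑ i, w i * f (p i) := by
  have hf : StronglyMeasurable f := f.continuous.measurable.stronglyMeasurable
  change ∫ x, f x ∂(∑ i, ENNReal.ofReal (w i) • Measure.dirac (p i)) = _
  rw [integral_finsetSum_measure]
  · refine Finset.sum_congr rfl fun i _ => ?_
    rw [integral_smul_measure, integral_dirac' _ _ hf, ENNReal.toReal_ofReal (hw.1 i),
      smul_eq_mul]
  · intro i _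
    exact (f.integrable _).smul_measure ENNReal.ofReal_ne_top

/-- Finitely supported probability measures are weakly dense. -/
lemma exists_finiteDirac_mem {X : Type*} [MetricSpace X] [CompactSpace X] [MeasurableSpace X]
    [BorelSpace X] {U : Set (ProbabilityMeasure X)} (hU : IsOpen U) (hne : U.Nonempty) :
    ∃ (S : Finset X) (w : S → ℝ) (hw : w ∈ stdSimplex ℝ S),
      finiteDirac w hw ((↑) : S → X) ∈ U := by
  obtain ⟨μ, hμ⟩ := hne
  obtain ⟨x₀⟩ : Nonempty X := μ.nonempty
  let s : ℕ → SimpleFunc X X := fun n =>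
    SimpleFunc.approxOn id measurable_id Set.univ x₀ (Set.mem_univ _) n
  let w : ∀ n, (s n).range → ℝ := fun n a => (μ : Measure X).real (s n ⁻¹' {(a : X)})
  have key (n : ℕ) (f : X → ℝ) :
      ∫ x, f (s n x) ∂(μ : Measure X) = ∑ a, w n a * f (a : X) := by
    have h : (fun x => f (s n x)) =
        fun x => ∑ a ∈ (s n).range, (s n ⁻¹' {a}).indicator (fun _ => f a) x := by
      ext x
      rw [Finset.sum_eq_single (s n x)]
      · simp
      · intro b _ hb
        exact Set.indicator_of_notMem (fun hx => hb hx.symm) _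
      · intro h
        exact absurd ((s n).mem_range_self x) h
    rw [h, integral_finsetSum]
    · rw [← Finset.sum_coe_sort]
      refine Finset.sum_congr rfl fun a _ => ?_
      rw [integral_indicator_const _ ((s n).measurableSet_fiber _), smul_eq_mul]
    · intro a _
      exact (integrable_const _).indicator ((s n).measurableSet_fiber _)
  have hw (n : ℕ) : w n ∈ stdSimplex ℝ (s n).range := by
    refine ⟨fun a => measureReal_nonneg, ?_⟩
    simpa using (key n fun _ => 1).symm
  have hlim : Tendsto (fun n => finiteDirac (w n) (hw n) ((↑) : (s n).range → X)) atTop (𝓝 μ) := by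
    rw [ProbabilityMeasure.tendsto_iff_forall_integral_tendsto]
    intro f
    simp_rw [integral_finiteDirac, ← key]
    refine tendsto_integral_of_dominated_convergence (fun _ => ‖f‖) ?_ (integrable_const _) ?_ ?_
    · exact fun n => (f.continuous.measurable.comp (s n).measurable).aestronglyMeasurable
    · exact fun n => ae_of_all _ fun x => f.norm_coe_le_norm _
    · exact ae_of_all _ fun x => (f.continuous.tendsto x).comp
        (SimpleFunc.tendsto_approxOn measurable_id (Set.mem_univ _) (by simp))
  obtain ⟨n, hn⟩ := (hlim.eventually (hU.mem_nhds hμ)).exists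
  exact ⟨_, _, hw n, hn⟩

/-- A finitely supported measure lifts along `π` by splitting each atom among preimages. -/
lemma exists_map_eq_finiteDirac {X Y ι κ : Type*} [TopologicalSpace X] [MeasurableSpace X]
    [BorelSpace X] [TopologicalSpace Y] [HasOuterApproxClosed Y] [MeasurableSpace Y] [BorelSpace Y]
    [Fintype ι] [Fintype κ] {π : X → Y} (hcont : Continuous π)
    (w : ι → ℝ) (hw : w ∈ stdSimplex ℝ ι) (p : ι → Y) (g : κ → Y → ℝ)
    (hg : ∀ y, (fun k => g k y) ∈ stdSimplex ℝ κ) (σ : κ → Y → X)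
    (hσ : ∀ k y, g k y ≠ 0 → π (σ k y) = y) :
    ∃ μ : ProbabilityMeasure X, μ.map hcont.measurable.aemeasurable = finiteDirac w hw p ∧
      ∀ f : X →ᵇ ℝ, ∫ x, f x ∂(μ : Measure X) =
        ∑ k, ∑ i, w i * g k (p i) * f (σ k (p i)) := by
  have hW : (fun a : κ × ι => w a.2 * g a.1 (p a.2)) ∈ stdSimplex ℝ (κ × ι) := by
    refine ⟨fun a => mul_nonneg (hw.1 _) ((hg _).1 _), ?_⟩
    rw [Fintype.sum_prod_type_right]
    simp_rw [← Finset.mul_sum]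
    simp [(hg _).2, hw.2]
  have hint (f : X →ᵇ ℝ) := integral_finiteDirac _ hW (fun a => σ a.1 (p a.2)) f
  refine ⟨finiteDirac _ hW fun a => σ a.1 (p a.2), ?_, fun f => ?_⟩
  · apply Subtype.ext
    change ProbabilityMeasure.toMeasure _ = ProbabilityMeasure.toMeasure _
    refine ext_of_forall_integral_eq_of_IsFiniteMeasure fun f => ?_
    rw [ProbabilityMeasure.toMeasure_map,
      integral_map hcont.measurable.aemeasurable f.continuous.measurable.aestronglyMeasurable,
      integral_finiteDirac]
    refine (hint (f.compContinuous ⟨π, hcont⟩)).trans ?_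
    rw [Fintype.sum_prod_type_right]
    refine Finset.sum_congr rfl fun i _ => ?_
    have h (k : κ) : w i * g k (p i) * f (π (σ k (p i))) = w i * f (p i) * g k (p i) := by
      by_cases h0 : g k (p i) = 0
      · simp [h0]
      · rw [hσ k _ h0]; ring
    simp only [BoundedContinuousFunction.compContinuous_apply, ContinuousMap.coe_mk, h]
    rw [← Finset.mul_sum, (hg _).2, mul_one]
  · rw [hint, Fintype.sum_prod_type]

end FiniteDirac

/-- A quantitative description of weak neighbourhoods on a compact metric space, in terms of a
modulus of continuity and a bound for the test functions. -/
lemma exists_forall_abs_integral_sub_le_imp_mem {X : Type*} [MetricSpace X] [CompactSpace X]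
    [MeasurableSpace X] [BorelSpace X] {U : Set (ProbabilityMeasure X)} (hU : IsOpen U)
    {μ : ProbabilityMeasure X} (hμ : μ ∈ U) :
    ∃ ε > 0, ∀ μ' : ProbabilityMeasure X,
      (∀ (f : X →ᵇ ℝ) (M δ : ℝ), 0 ≤ M → 0 ≤ δ → (∀ x, |f x| ≤ M) →
        (∀ x y, dist x y < ε → |f x - f y| ≤ δ) →
        |∫ x, f x ∂(μ' : Measure X) - ∫ x, f x ∂(μ : Measure X)| ≤ δ + ε * M) → μ' ∈ U := by
  by_contra! hcon
  choose ν hν hνU using fun n : ℕ => hcon (1 / ((n : ℝ) + 1)) Nat.one_div_pos_of_nat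
  have hlim : Tendsto ν atTop (𝓝 μ) := by
    rw [ProbabilityMeasure.tendsto_iff_forall_integral_tendsto]
    intro f
    rw [Metric.tendsto_atTop']
    intro η hη
    obtain ⟨d, hd, hfd⟩ := Metric.uniformContinuous_iff.1
      (CompactSpace.uniformContinuous_of_continuous f.continuous) (η / 2) (half_pos hη)
    have h0 := tendsto_one_div_add_atTop_nhds_zero_nat (𝕜 := ℝ)
    have h1 : Tendsto (fun n : ℕ => 1 / ((n : ℝ) + 1) * ‖f‖) atTop (𝓝 0) := by
      simpa using h0.mul_const ‖f‖
    obtain ⟨N, hN⟩ := eventually_atTop.1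
      ((h0.eventually_lt_const hd).and (h1.eventually_lt_const (half_pos hη)))
    refine ⟨N, fun n hn => ?_⟩
    obtain ⟨hnd, hnη⟩ := hN n hn.le
    have := hν n f ‖f‖ (η / 2) (norm_nonneg _) (half_pos hη).le f.norm_coe_le_norm
      fun x y hxy => (hfd (hxy.trans hnd)).le
    rw [Real.dist_eq]
    linarith
  obtain ⟨n, hn⟩ := (hlim.eventually (hU.mem_nhds hμ)).exists
  exact hνU n hn

/-- Bump functions `g i` subordinate to `W i`, reproducing the weights `w` when integrated against
`∑ j, w j • δ_{y j}`. -/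
lemma exists_bump_sum_mul_eq {Y ι : Type*} [TopologicalSpace Y] [CompactSpace Y] [T2Space Y]
    [Fintype ι] (w : ι → ℝ) (hw : ∀ i, 0 ≤ w i) (y : ι → Y) (W : ι → Set Y)
    (hW : ∀ i, IsOpen (W i)) (hy : ∀ i, y i ∈ W i) :
    ∃ g : ι → Y →ᵇ ℝ, (∀ i z, 0 ≤ g i z) ∧ (∀ z, ∑ i, g i z ≤ 1) ∧
      (∀ i z, g i z ≠ 0 → z ∈ W i) ∧ ∀ i, ∑ j, w j * g i (y j) = w i := by
  classical
  obtain ⟨V, hV, hdisj⟩ := (Set.finite_range y).t2_separation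
  let O : Y → Set Y := fun z => V z ∩ ⋂ i ∈ {i | y i = z}, W i
  have hO (z) : IsOpen (O z) :=
    (hV z).2.inter (Set.toFinite _ |>.isOpen_biInter fun i _ => hW i)
  have hzO (z) : z ∈ O z :=
    ⟨(hV z).1, Set.mem_iInter₂.2 fun i (hi : y i = z) => hi ▸ hy i⟩
  choose h h0 h1 h01 using fun z => exists_continuous_zero_one_of_isClosed (hO z).isClosed_compl
    (isClosed_singleton (x := z))
    (Set.disjoint_singleton_right.2 fun hz => hz (hzO z))
  have hsupp (z u) (hu : h z u ≠ 0) : u ∈ O z := by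
    by_contra hc
    exact hu (h0 z hc)
  have huniq (i j u) (hi : h (y i) u ≠ 0) (hj : h (y j) u ≠ 0) : y i = y j := by
    by_contra hc
    exact Set.disjoint_left.1 (hdisj (Set.mem_range_self i) (Set.mem_range_self j) hc)
      (hsupp _ _ hi).1 (hsupp _ _ hj).1
  let C : Y → ℝ := fun z => ∑ j with y j = z, w j
  have hC (z) : 0 ≤ C z := Finset.sum_nonneg fun j _ => hw j
  refine ⟨fun i => (w i / C (y i)) • BoundedContinuousFunction.mkOfCompact (h (y i)), ?_, ?_, ?_, ?_⟩
  · exact fun i z => mul_nonneg (div_nonneg (hw i) (hC _)) (h01 _ z).1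
  · intro u
    simp only [BoundedContinuousFunction.coe_smul, BoundedContinuousFunction.mkOfCompact_apply,
      smul_eq_mul]
    by_cases hex : ∃ i, h (y i) u ≠ 0
    · obtain ⟨i, hi⟩ := hex
      calc ∑ j, w j / C (y j) * h (y j) u
          = ∑ j with y j = y i, w j / C (y i) * h (y i) u := by
            rw [Finset.sum_filter]
            refine Finset.sum_congr rfl fun j _ => ?_
            split_ifs with hj
            · rw [hj]
            · by_contra hne
              exact hj (huniq j i u (right_ne_zero_of_mul hne) hi)
        _ = C (y i) / C (y i) * h (y i) u := by
            rw [← Finset.sum_mul, ← Finset.sum_div]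
        _ ≤ 1 * 1 := mul_le_mul (div_self_le_one _) (h01 _ u).2 (h01 _ u).1 zero_le_one
        _ = 1 := one_mul 1
    · push Not at hex
      simp [hex]
  · intro i z hz
    exact Set.mem_iInter₂.1 (hsupp (y i) z (right_ne_zero_of_mul hz)).2 i rfl
  · intro i
    simp only [BoundedContinuousFunction.coe_smul, BoundedContinuousFunction.mkOfCompact_apply,
      smul_eq_mul]
    calc ∑ j, w j * (w i / C (y i) * h (y i) (y j))
        = ∑ j with y j = y i, w j * (w i / C (y i)) := by
          rw [Finset.sum_filter]
          refine Finset.sum_congr rfl fun j _ => ?_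
          have hj1 : h (y j) (y j) = 1 := h1 (y j) rfl
          split_ifs with hj
          · rw [← hj, hj1, mul_one]
          · by_contra hne
            exact hj (huniq j i (y j) (by simp [hj1])
              (right_ne_zero_of_mul (right_ne_zero_of_mul hne)))
      _ = C (y i) * (w i / C (y i)) := by rw [← Finset.sum_mul]
      _ = w i := by
          refine mul_div_cancel_of_imp' fun hz => ?_
          exact (Finset.sum_eq_zero_iff_of_nonneg fun j _ => hw j).1 hz i (by simp)

/-- Comparison of a finite sum over points `x i` with weights `w i` and a perturbation of it in
which the mass near `x i` has been spread out, up to a small remainder. -/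
lemma abs_sum_option_sub_sum_le {ι κ : Type*} [Fintype ι] [Fintype κ] {w F : ι → ℝ}
    {m : Option ι → κ → ℝ} {φ : Option ι → κ → ℝ} {M δ ε : ℝ} (hM : 0 ≤ M) (hδ : 0 ≤ δ)
    (hw : ∑ i, w i = 1) (hm : ∀ k j, 0 ≤ m k j) (hm1 : ∑ k, ∑ j, m k j = 1)
    (hF : ∀ i, |F i| ≤ M) (hφ : ∀ j, |φ none j| ≤ M)
    (hφF : ∀ i j, m (some i) j ≠ 0 → |φ (some i) j - F i| ≤ δ)
    (hclose : ∑ i, |∑ j, m (some i) j - w i| ≤ ε / 2) :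
    |∑ k, ∑ j, m k j * φ k j - ∑ i, w i * F i| ≤ δ + ε * M := by
  rw [Fintype.sum_option] at hm1 ⊢
  have h0 : ∑ j, m none j ≤ ε / 2 := by
    have : ∑ j, m none j = -∑ i, (∑ j, m (some i) j - w i) := by
      rw [Finset.sum_sub_distrib, hw]; linarith
    rw [this]
    exact (neg_le_abs _).trans ((Finset.abs_sum_le_sum_abs _ _).trans hclose)
  have hA : |∑ j, m none j * φ none j| ≤ ε / 2 * M := by
    refine (Finset.abs_sum_le_sum_abs _ _).trans ?_
    refine le_trans (Finset.sum_le_sum fun j _ => ?_)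
      ((Finset.sum_mul _ _ M).symm.le.trans (mul_le_mul_of_nonneg_right h0 hM))
    rw [abs_mul, abs_of_nonneg (hm _ _)]
    exact mul_le_mul_of_nonneg_left (hφ j) (hm _ _)
  have hB : |∑ i, ∑ j, m (some i) j * (φ (some i) j - F i)| ≤ δ := by
    calc |∑ i, ∑ j, m (some i) j * (φ (some i) j - F i)|
        ≤ ∑ i, ∑ j, m (some i) j * δ := by
          refine (Finset.abs_sum_le_sum_abs _ _).trans (Finset.sum_le_sum fun i _ => ?_)
          refine (Finset.abs_sum_le_sum_abs _ _).trans (Finset.sum_le_sum fun j _ => ?_)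
          rw [abs_mul, abs_of_nonneg (hm _ _)]
          by_cases hz : m (some i) j = 0
          · simp [hz]
          · exact mul_le_mul_of_nonneg_left (hφF i j hz) (hm _ _)
      _ = (∑ i, ∑ j, m (some i) j) * δ := by simp_rw [Finset.sum_mul]
      _ ≤ 1 * δ := by
          refine mul_le_mul_of_nonneg_right ?_ hδ
          have : 0 ≤ ∑ j, m none j := Finset.sum_nonneg fun j _ => hm _ _
          linarith
      _ = δ := one_mul δ
  have hD : |∑ i, (∑ j, m (some i) j - w i) * F i| ≤ ε / 2 * M := by
    refine (Finset.abs_sum_le_sum_abs _ _).trans ?_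
    refine le_trans (Finset.sum_le_sum fun i _ => ?_)
      ((Finset.sum_mul _ _ M).symm.le.trans (mul_le_mul_of_nonneg_right hclose hM))
    rw [abs_mul]
    exact mul_le_mul_of_nonneg_left (hF i) (abs_nonneg _)
  have hsplit : (∑ j, m none j * φ none j + ∑ i, ∑ j, m (some i) j * φ (some i) j) -
      ∑ i, w i * F i = ∑ j, m none j * φ none j +
        ∑ i, ∑ j, m (some i) j * (φ (some i) j - F i) +
        ∑ i, (∑ j, m (some i) j - w i) * F i := by
    simp only [mul_sub, sub_mul, Finset.sum_sub_distrib, Finset.sum_mul]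
    ring
  rw [hsplit]
  calc _ ≤ _ := abs_add_three _ _ _
    _ ≤ ε / 2 * M + δ + ε / 2 * M := by gcongr
    _ = δ + ε * M := by ring

section Pushforward

variable {X Y : Type*} [MetricSpace X] [CompactSpace X] [MetricSpace Y] [CompactSpace Y]
  [MeasurableSpace X] [BorelSpace X] [MeasurableSpace Y] [BorelSpace Y] {π : X → Y}

/-- A closed set of probability measures on `Y` contains an open set as soon as it contains the
finitely supported members of that open set. -/
lemma subset_of_forall_finiteDirac_mem {T C : Set (ProbabilityMeasure Y)} (hT : IsOpen T)
    (hC : IsClosed C)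
    (h : ∀ (S : Finset Y) (w : S → ℝ) (hw : w ∈ stdSimplex ℝ S),
      finiteDirac w hw ((↑) : S → Y) ∈ T → finiteDirac w hw ((↑) : S → Y) ∈ C) : T ⊆ C := by
  intro ν hν
  by_contra hνC
  obtain ⟨S, w, hw, hT', hC'⟩ :=
    exists_finiteDirac_mem (hT.inter hC.isOpen_compl) ⟨ν, hν, hνC⟩
  exact hC' (h S w hw hT')

lemma surjective_probabilityMeasure_map (hcont : Continuous π) (hsurj : Function.Surjective π) :
    Function.Surjective (fun μ : ProbabilityMeasure X =>
      μ.map hcont.measurable.aemeasurable) := by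
  rw [← Set.range_eq_univ, ← Set.univ_subset_iff]
  refine subset_of_forall_finiteDirac_mem isOpen_univ
    (isCompact_range (ProbabilityMeasure.continuous_map hcont)).isClosed fun S w hw _ => ?_
  obtain ⟨μ, hμ, -⟩ := exists_map_eq_finiteDirac hcont w hw (↑) (fun (_ : Unit) _ => 1)
    (fun _ => ⟨fun _ => zero_le_one, by simp⟩) (fun _ => Function.surjInv hsurj)
    fun _ y _ => Function.surjInv_eq hsurj y
  exact ⟨μ, hμ⟩

lemma nonempty_interior_image_probabilityMeasure_map (hcont : Continuous π)
    (hsurj : Function.Surjective π)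
    (hso : ∀ U : Set X, IsOpen U → U.Nonempty → (interior (π '' U)).Nonempty)
    {U : Set (ProbabilityMeasure X)} (hU : IsOpen U) (hne : U.Nonempty) :
    (interior ((fun μ : ProbabilityMeasure X =>
      μ.map hcont.measurable.aemeasurable) '' U)).Nonempty := by
  obtain ⟨μ, hμ⟩ := hne
  obtain ⟨V, hV, hμV, hVU⟩ : ∃ V, IsOpen V ∧ μ ∈ V ∧ closure V ⊆ U := by
    obtain ⟨t, ht, htc, htU⟩ := exists_mem_nhds_isClosed_subset (hU.mem_nhds hμ)
    exact ⟨interior t, isOpen_interior, mem_interior_iff_mem_nhds.2 ht,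
      (closure_minimal interior_subset htc).trans htU⟩
  obtain ⟨S, w, hw, hwV⟩ := exists_finiteDirac_mem hV ⟨μ, hμV⟩
  obtain ⟨ε, hε, hεV⟩ := exists_forall_abs_integral_sub_le_imp_mem hV hwV
  choose y hy using fun x : S => hso (Metric.ball (x : X) ε) Metric.isOpen_ball
    ⟨x, Metric.mem_ball_self hε⟩
  obtain ⟨g, hg0, hg1, hgW, hgw⟩ := exists_bump_sum_mul_eq w hw.1 y _
    (fun _ => isOpen_interior) hy
  let T : Set (ProbabilityMeasure Y) :=
    {ν | ∑ x, |∫ z, g x z ∂(ν : Measure Y) - w x| < ε / 2}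
  have hT : IsOpen T := by
    refine isOpen_lt (continuous_finsetSum _ fun x _ => ?_) continuous_const
    exact ((ProbabilityMeasure.continuous_integral_boundedContinuousFunction (g x)).sub
      continuous_const).abs
  have hTne : finiteDirac w hw y ∈ T := by
    simp only [T, Set.mem_ofPred_eq, integral_finiteDirac, hgw, sub_self, abs_zero,
      Finset.sum_const_zero]
    exact half_pos hε
  have hclosed := (isClosed_closure (s := V)).isCompact.image
    (ProbabilityMeasure.continuous_map hcont) |>.isClosed
  refine ⟨_, interior_mono (Set.image_mono hVU)
    (interior_maximal (subset_of_forall_finiteDirac_mem hT hclosed ?_) hT hTne)⟩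
  intro S' b hb hbT
  have hsec (x : S) (z : Y) : ∃ u, g x z ≠ 0 → u ∈ Metric.ball (x : X) ε ∧ π u = z := by
    by_cases hz : g x z = 0
    · exact ⟨x, fun h => absurd hz h⟩
    · obtain ⟨u, hu⟩ := interior_subset (hgW x z hz)
      exact ⟨u, fun _ => hu⟩
  choose τ hτ using hsec
  let G : Option S → Y → ℝ := fun k z => k.elim (1 - ∑ x, g x z) fun x => g x z
  let σ : Option S → Y → X := fun k z => k.elim (Function.surjInv hsurj z) fun x => τ x z
  have hG (z : Y) : (fun k => G k z) ∈ stdSimplex ℝ (Option S) := by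
    refine ⟨?_, by simp [G, Fintype.sum_option]⟩
    rintro (_ | x)
    · exact sub_nonneg.2 (hg1 z)
    · exact hg0 x z
  have hσ (k : Option S) (z : Y) (hk : G k z ≠ 0) : π (σ k z) = z := by
    rcases k with _ | x
    · exact Function.surjInv_eq hsurj z
    · exact (hτ x z hk).2
  obtain ⟨μ', hμ', hint⟩ := exists_map_eq_finiteDirac hcont b hb (↑) G hG σ hσ
  refine ⟨μ', subset_closure (hεV μ' fun f M δ hM hδ hfM hfδ => ?_), hμ'⟩
  rw [hint, integral_finiteDirac]
  refine abs_sum_option_sub_sum_le (m := fun k z => b z * G k z) (φ := fun k z => f (σ k z))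
    hM hδ hw.2 (fun k z => mul_nonneg (hb.1 z) ((hG z).1 k)) ?_ (fun x => hfM x)
    (fun z => hfM _) ?_ ?_
  · rw [Finset.sum_comm]
    simp_rw [← Finset.mul_sum]
    simp only [(hG _).2, mul_one, hb.2]
  · intro x z hz
    exact hfδ _ _ (hτ x z (right_ne_zero_of_mul hz)).1
  · simp only [T, Set.mem_ofPred_eq, integral_finiteDirac] at hbT
    exact hbT.le

end Pushforward

/-- If `π : X → Y` is a semiopen continuous surjection between compact metric
spaces, then the induced pushforward map `π_* : M(X) → M(Y)` between the spaces
of Borel probability measures with the weak* topology is a semiopen continuous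
surjection. -/
theorem pushforward_semiopen_of_semiopen {X Y : Type*}
    [MetricSpace X] [CompactSpace X] [MetricSpace Y] [CompactSpace Y]
    [MeasurableSpace X] [BorelSpace X] [MeasurableSpace Y] [BorelSpace Y]
    (π : X → Y) (hcont : Continuous π) (hsurj : Function.Surjective π)
    (hso : ∀ U : Set X, IsOpen U → U.Nonempty → (interior (π '' U)).Nonempty) :
    Continuous (fun μ : ProbabilityMeasure X =>
        μ.map hcont.measurable.aemeasurable) ∧
    Function.Surjective (fun μ : ProbabilityMeasure X =>
        μ.map hcont.measurable.aemeasurable) ∧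
    (∀ U : Set (ProbabilityMeasure X), IsOpen U → U.Nonempty →
      (interior ((fun μ : ProbabilityMeasure X =>
        μ.map hcont.measurable.aemeasurable) '' U)).Nonempty) := by
  exact ⟨ProbabilityMeasure.continuous_map hcont, surjective_probabilityMeasure_map hcont hsurj,
    fun _ hU hne => nonempty_interior_image_probabilityMeasure_map hcont hsurj hso hU hne⟩
end

section
/- Let Γ be a group acting by homeomorphisms on compact Hausdorff spaces X and Y, with both actions minimal, and let π : X → Y be a continuous Γ-equivariant surjection. Then π is semiopen. -/
/-- A continuous equivariant surjection between minimal compact Hausdorff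
dynamical systems is semiopen. -/
theorem semiopen_of_minimal {Γ X Y : Type*} [Group Γ]
    [TopologicalSpace X] [CompactSpace X] [T2Space X]
    [TopologicalSpace Y] [CompactSpace Y] [T2Space Y]
    [MulAction Γ X] [MulAction Γ Y]
    (hX : ∀ γ : Γ, Continuous fun x : X => γ • x)
    (hY : ∀ γ : Γ, Continuous fun y : Y => γ • y)
    (hminX : ∀ x : X, Dense (MulAction.orbit Γ x))
    (hminY : ∀ y : Y, Dense (MulAction.orbit Γ y))
    (π : X → Y) (hcont : Continuous π) (hsurj : Function.Surjective π)
    (hequiv : ∀ (γ : Γ) (x : X), π (γ • x) = γ • π x) :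
    ∀ U : Set X, IsOpen U → U.Nonempty → (interior (π '' U)).Nonempty := by
  intro U hU hne
  have : ContinuousConstSMul Γ X := ⟨hX⟩
  have : ContinuousConstSMul Γ Y := ⟨hY⟩
  have : MulAction.IsMinimal Γ X := ⟨hminX⟩
  obtain ⟨x, hx⟩ := hne
  obtain ⟨K, hKc, hxK, hKU⟩ := exists_compact_subset hU hx
  obtain ⟨t, ht⟩ := isCompact_univ.exists_finite_cover_smul Γ
    (isOpen_interior (s := K)) ⟨x, hxK⟩
  have : Nonempty Y := ⟨π x⟩
  have hclosed : ∀ γ : t, IsClosed ((fun y : Y => (γ : Γ)⁻¹ • y) ⁻¹' (π '' K)) := fun γ =>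
    (hKc.image hcont).isClosed.preimage (hY _)
  have hcover : ⋃ γ : t, (fun y : Y => (γ : Γ)⁻¹ • y) ⁻¹' (π '' K) = Set.univ := by
    refine Set.eq_univ_of_forall fun y => ?_
    obtain ⟨z, rfl⟩ := hsurj y
    obtain ⟨γ, hγ, hz⟩ := Set.mem_iUnion₂.mp (ht (Set.mem_univ z))
    exact Set.mem_iUnion.mpr ⟨⟨γ, hγ⟩, γ⁻¹ • z,
      interior_subset (Set.mem_smul_set_iff_inv_smul_mem.mp hz), hequiv _ _⟩
  obtain ⟨γ, y, hy⟩ := nonempty_interior_of_iUnion_of_closed hclosed hcover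
  refine ⟨(γ : Γ)⁻¹ • y, mem_interior.mpr
    ⟨(fun w : Y => (γ : Γ) • w) ⁻¹' interior _, fun w hw => ?_,
      isOpen_interior.preimage (hY _), by simpa using hy⟩⟩
  have hwK : (γ : Γ)⁻¹ • (γ : Γ) • w ∈ π '' K := by
    exact Set.mem_preimage.mp (interior_subset (Set.mem_preimage.mp hw))
  rw [inv_smul_smul] at hwK
  exact Set.image_mono hKU hwK
end

section
/- Let Γ be a group acting by homeomorphisms on compact metric spaces Z and Y with both actions minimal, and let θ : Z → Y be a continuous Γ-equivariant surjection which is almost 1-1, i.e. the set { z ∈ Z : θ⁻¹({θ(z)}) = {z} } is dense in Z. Then for every nonempty open subset O of Z there exists a nonempty open subset V ⊆ O such that θ⁻¹(θ(V)) ⊆ O. -/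
/-- If `θ : Z → Y` is an almost 1-1 continuous equivariant surjection between
minimal compact metric dynamical systems, then every nonempty open `O ⊆ Z`
contains a nonempty open `V` with `θ⁻¹(θ(V)) ⊆ O`. -/
theorem exists_saturated_open_of_almost_one_one {Γ Z Y : Type*} [Group Γ]
    [MetricSpace Z] [CompactSpace Z] [MetricSpace Y] [CompactSpace Y]
    [MulAction Γ Z] [MulAction Γ Y]
    (hZ : ∀ γ : Γ, Continuous fun z : Z => γ • z)
    (hY : ∀ γ : Γ, Continuous fun y : Y => γ • y)
    (hminZ : ∀ z : Z, Dense (MulAction.orbit Γ z))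
    (hminY : ∀ y : Y, Dense (MulAction.orbit Γ y))
    (θ : Z → Y) (hcont : Continuous θ) (hsurj : Function.Surjective θ)
    (hequiv : ∀ (γ : Γ) (z : Z), θ (γ • z) = γ • θ z)
    (halmost : Dense {z : Z | θ ⁻¹' {θ z} = {z}}) :
    ∀ O : Set Z, IsOpen O → O.Nonempty →
      ∃ V : Set Z, IsOpen V ∧ V.Nonempty ∧ V ⊆ O ∧ θ ⁻¹' (θ '' V) ⊆ O := by
  intro O hO hne
  obtain ⟨z, hzO, hz⟩ := halmost.inter_open_nonempty O hO hne
  have hsub : θ ⁻¹' (θ '' Oᶜ)ᶜ ⊆ O := fun x hx => by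
    by_contra hxO
    exact hx ⟨x, hxO, rfl⟩
  refine ⟨θ ⁻¹' (θ '' Oᶜ)ᶜ,
    (hcont.isClosedMap _ hO.isClosed_compl).isOpen_compl.preimage hcont,
    ⟨z, ?_⟩, hsub, ?_⟩
  · rintro ⟨x, hxO, hx⟩
    have hxz : x ∈ θ ⁻¹' {θ z} := hx
    rw [hz] at hxz
    exact hxO (hxz ▸ hzO)
  · exact (Set.preimage_mono (Set.image_preimage_subset _ _)).trans hsub
end

section
/- Let Γ be a group acting by homeomorphisms on a compact metric space X, and assume (X,Γ) is tame, i.e. every element of the enveloping semigroup E(X,Γ) is the pointwise limit of a sequence of translation maps by elements of Γ. Then every p ∈ E(X,Γ) is Borel measurable and induces a map p_* : M(X) → M(X) by pushforward of measures; p_* belongs to the enveloping semigroup E(M(X),Γ) of the induced Γ-action on M(X), and the assignment p ↦ p_* is a bijection from E(X,Γ) onto E(M(X),Γ) satisfying (p ∘ q)_* = p_* ∘ q_* for all p, q ∈ E(X,Γ). -/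
open MeasureTheory Filter

theorem not_measurableSet_setOf_eventually_eq_zero {U : Ultrafilter ℕ}
    (hU : (U : Filter ℕ) ≤ atTop) :
    ¬ MeasurableSet {s : ℕ → ZMod 2 | ∀ᶠ n in (U : Filter ℕ), s n = 0} := by
  intro hK
  set K : Set (ℕ → ZMod 2) := {s | ∀ᶠ n in (U : Filter ℕ), s n = 0}
  have key : ∀ {T : Set (ℕ → ZMod 2)}, MeasurableSet T →
      0 < (Measure.addHaar : Measure (ℕ → ZMod 2)) T → (∀ s ∈ T, ∀ t ∈ T, s - t ∈ K) →
      K ∈ nhds (0 : ℕ → ZMod 2) := by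
    intro T hT hpos hsub
    refine mem_of_superset (Measure.sub_mem_nhds_zero_of_addHaar_pos_ne_top
      Measure.addHaar T hT hpos (measure_ne_top _ _)) ?_
    rintro _ ⟨s, hs, t, ht, rfl⟩
    exact hsub s hs t ht
  have hnhds : K ∈ nhds (0 : ℕ → ZMod 2) := by
    by_cases h0 : (Measure.addHaar : Measure (ℕ → ZMod 2)) K = 0
    · refine key hK.compl ?_ ?_
      · rw [measure_compl hK (measure_ne_top _ _), h0, tsub_zero]
        exact isOpen_univ.measure_pos _ ⟨0, trivial⟩
      · intro s hs t ht
        have hs' := Ultrafilter.eventually_not.2 hs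
        have ht' := Ultrafilter.eventually_not.2 ht
        filter_upwards [hs', ht'] with n h1 h2
        have : ∀ a b : ZMod 2, a ≠ 0 → b ≠ 0 → a - b = 0 := by decide
        exact this _ _ h1 h2
    · refine key hK (pos_iff_ne_zero.2 h0) ?_
      intro s hs t ht
      filter_upwards [hs, ht] with n h1 h2
      simp [h1, h2]
  let e : ℕ → ℕ → ZMod 2 := fun m n => if m ≤ n then 1 else 0
  have he : Tendsto e atTop (nhds 0) := by
    rw [tendsto_pi_nhds]
    intro n
    refine tendsto_const_nhds.congr' ?_
    filter_upwards [eventually_gt_atTop n] with m hm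
    simp [e, hm]
  obtain ⟨m, hm⟩ := (he.eventually hnhds).exists
  have h1 : ∀ᶠ n in (U : Filter ℕ), m ≤ n := hU (eventually_ge_atTop m)
  have h2 : ∀ᶠ n in (U : Filter ℕ), e m n = 0 := hm
  obtain ⟨n, hn1, hn2⟩ := (h1.and h2).exists
  simp [e, hn1] at hn2

theorem exists_weak_limit_of_bounded {ι Ω : Type*} [MeasurableSpace Ω] (ν : Measure Ω)
    [IsFiniteMeasure ν] {a : ι → Ω → ℝ} (ha : ∀ i, Measurable (a i)) {M : ℝ}
    (hM : ∀ i x, |a i x| ≤ M) (F : Ultrafilter ι) :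
    ∃ h : Ω → ℝ, Measurable h ∧ Integrable h ν ∧ ∀ S, MeasurableSet S →
      Tendsto (fun i => ∫ x in S, a i x ∂ν) F (nhds (∫ x in S, h x ∂ν)) := by
  have hmem : ∀ i, MemLp (a i) 2 ν := fun i =>
    MemLp.of_bound (ha i).aestronglyMeasurable M (Eventually.of_forall (hM i))
  let A : ι → Lp ℝ 2 ν := fun i => (hmem i).toLp
  let D : ι → WeakDual ℝ (Lp ℝ 2 ν) := fun i =>
    StrongDual.toWeakDual (InnerProductSpace.toDual ℝ (Lp ℝ 2 ν) (A i))
  obtain ⟨R, hR⟩ : ∃ R : ℝ, ∀ i, ‖A i‖ ≤ R := by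
    refine ⟨_, fun i => Lp.norm_le_of_ae_bound (C := max M 0) (le_max_right _ _) ?_⟩
    filter_upwards [(hmem i).coeFn_toLp] with x hx
    rw [hx]
    exact (hM i x).trans (le_max_left _ _)
  obtain ⟨d, -, hd⟩ := (WeakDual.isCompact_closedBall (𝕜 := ℝ) (E := Lp ℝ 2 ν) 0 R).ultrafilter_le_nhds
    (F.map D) (by
      rw [le_principal_iff]
      refine Filter.mem_map.2 (Eventually.of_forall fun i => ?_)
      have : ‖InnerProductSpace.toDual ℝ (Lp ℝ 2 ν) (A i)‖ ≤ R := by simpa using hR i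
      simpa [D] using this)
  let H : Lp ℝ 2 ν := (InnerProductSpace.toDual ℝ (Lp ℝ 2 ν)).symm (WeakDual.toStrongDual d)
  have hHi : Integrable H ν := (Lp.memLp H).integrable (by norm_num)
  have hHm := (Lp.aestronglyMeasurable H).aemeasurable
  refine ⟨hHm.mk _, hHm.measurable_mk, hHi.congr hHm.ae_eq_mk, fun S hS => ?_⟩
  have hev := ((WeakDual.eval_continuous
    (indicatorConstLp 2 hS (measure_ne_top ν S) (1 : ℝ))).tendsto d).comp hd
  have e1 : ∀ i, D i (indicatorConstLp 2 hS (measure_ne_top ν S) (1 : ℝ)) = ∫ x in S, a i x ∂ν := by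
    intro i
    change inner ℝ (A i) _ = _
    rw [real_inner_comm, L2.inner_indicatorConstLp_one]
    exact integral_congr_ae (ae_restrict_of_ae (hmem i).coeFn_toLp)
  have e2 : d (indicatorConstLp 2 hS (measure_ne_top ν S) (1 : ℝ)) = ∫ x in S, hHm.mk _ x ∂ν := by
    have : d (indicatorConstLp 2 hS (measure_ne_top ν S) (1 : ℝ)) =
      inner ℝ H (indicatorConstLp 2 hS (measure_ne_top ν S) (1 : ℝ)) := by
      simp [H]
    rw [this, real_inner_comm, L2.inner_indicatorConstLp_one]
    exact integral_congr_ae (ae_restrict_of_ae hHm.ae_eq_mk)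
  rw [← e2]
  refine hev.congr fun i => ?_
  exact e1 i

theorem exists_independent_seq {ι X : Type*} [TopologicalSpace X] [CompactSpace X]
    {a : ι → X → ℝ} (ha : ∀ i, Continuous (a i)) {F : Filter ι} [F.NeBot] {α β : ℝ}
    {P : Set X → Prop} (huniv : P Set.univ) (hne : ∀ V, P V → V.Nonempty)
    (hstep : ∀ V, P V → ∀ᶠ i in F, P (V ∩ {x | a i x < α}) ∧ P (V ∩ {x | β < a i x})) :
    ∃ i : ℕ → ι, ∀ σ : Set ℕ, ∃ x, ∀ n, (n ∈ σ → β ≤ a (i n) x) ∧ (n ∉ σ → a (i n) x ≤ α) := by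
  classical
  have hnx : ∀ 𝓥 : {𝓥 : Set (Set X) // 𝓥.Finite ∧ ∀ V ∈ 𝓥, P V}, ∃ i, ∀ V ∈ 𝓥.1,
      P (V ∩ {x | a i x < α}) ∧ P (V ∩ {x | β < a i x}) := fun 𝓥 =>
    ((eventually_all_finite 𝓥.2.1).2 fun V hV => hstep V (𝓥.2.2 V hV)).exists
  choose nx hnx using hnx
  let step : {𝓥 : Set (Set X) // 𝓥.Finite ∧ ∀ V ∈ 𝓥, P V} →
      {𝓥 : Set (Set X) // 𝓥.Finite ∧ ∀ V ∈ 𝓥, P V} := fun 𝓥 =>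
    ⟨(fun V => V ∩ {x | a (nx 𝓥) x < α}) '' 𝓥.1 ∪ (fun V => V ∩ {x | β < a (nx 𝓥) x}) '' 𝓥.1,
      (𝓥.2.1.image _).union (𝓥.2.1.image _), by
        rintro _ (⟨V, hV, rfl⟩ | ⟨V, hV, rfl⟩)
        exacts [(hnx 𝓥 V hV).1, (hnx 𝓥 V hV).2]⟩
  let S : ℕ → {𝓥 : Set (Set X) // 𝓥.Finite ∧ ∀ V ∈ 𝓥, P V} := fun n =>
    Nat.rec ⟨{Set.univ}, Set.finite_singleton _, by simpa using huniv⟩ (fun _ => step) n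
  refine ⟨fun n => nx (S n), fun σ => ?_⟩
  let C : ℕ → Set X := fun n => {x | ∀ k < n,
    (k ∈ σ → β ≤ a (nx (S k)) x) ∧ (k ∉ σ → a (nx (S k)) x ≤ α)}
  have hC : ∀ n, ∃ V ∈ (S n).1, V ⊆ C n := by
    intro n
    induction n with
    | zero => exact ⟨Set.univ, rfl, fun x _ k hk => absurd hk k.not_lt_zero⟩
    | succ n ih =>
      obtain ⟨V, hV, hVC⟩ := ih
      by_cases hn : n ∈ σ
      · refine ⟨_, Or.inr ⟨V, hV, rfl⟩, fun x hx k hk => ?_⟩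
        rcases Nat.lt_succ_iff_lt_or_eq.1 hk with h | rfl
        · exact hVC hx.1 k h
        · exact ⟨fun _ => le_of_lt hx.2, fun h => absurd hn h⟩
      · refine ⟨_, Or.inl ⟨V, hV, rfl⟩, fun x hx k hk => ?_⟩
        rcases Nat.lt_succ_iff_lt_or_eq.1 hk with h | rfl
        · exact hVC hx.1 k h
        · exact ⟨fun h => absurd h hn, fun _ => le_of_lt hx.2⟩
  have hclosed : ∀ n, IsClosed (C n) := by
    intro n
    simp only [C, Set.ofPred_forall, Set.ofPred_and]
    refine isClosed_iInter fun k => isClosed_iInter fun _ => IsClosed.inter ?_ ?_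
    · exact isClosed_iInter fun _ => isClosed_le continuous_const (ha _)
    · exact isClosed_iInter fun _ => isClosed_le (ha _) continuous_const
  obtain ⟨x, hx⟩ := IsCompact.nonempty_iInter_of_sequence_nonempty_isCompact_isClosed C
    (fun n x hx k hk => hx k (hk.trans n.lt_succ_self))
    (fun n => by
      obtain ⟨V, hV, hVC⟩ := hC n
      exact (hne V ((S n).2.2 V hV)).mono hVC)
    (hclosed 0).isCompact hclosed
  exact ⟨x, fun n => Set.mem_iInter.1 hx (n + 1) n n.lt_succ_self⟩

theorem exists_ultrafilter_limit {ι X : Type*} {a : ι → X → ℝ} {M : ℝ}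
    (hM : ∀ i x, |a i x| ≤ M) (F : Ultrafilter ι) :
    ∃ q : X → ℝ, ∀ x, Tendsto (fun i => a i x) F (nhds (q x)) := by
  have : ∀ x, ∃ y, Tendsto (fun i => a i x) F (nhds y) := fun x => by
    obtain ⟨y, -, hy⟩ := (isCompact_Icc (a := -M) (b := M)).ultrafilter_le_nhds
      (F.map fun i => a i x) (le_principal_iff.2 <| Filter.mem_map.2 <|
        Eventually.of_forall fun i => abs_le.1 (hM i x))
    exact ⟨y, hy⟩
  choose q hq using this
  exact ⟨q, hq⟩

theorem exists_nonmeasurable_limit_of_independent {ι X : Type*} [MetricSpace X] [CompactSpace X]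
    [MeasurableSpace X] [BorelSpace X] {a : ι → X → ℝ} (ha : ∀ i, Continuous (a i)) {M : ℝ}
    (hM : ∀ i x, |a i x| ≤ M) {α β : ℝ} (hαβ : α < β) {i : ℕ → ι}
    (hi : ∀ σ : Set ℕ, ∃ x, ∀ n, (n ∈ σ → β ≤ a (i n) x) ∧ (n ∉ σ → a (i n) x ≤ α)) :
    ∃ (G : Ultrafilter ι) (q : X → ℝ),
      (∀ x, Tendsto (fun j => a j x) G (nhds (q x))) ∧ ¬ Measurable q := by
  obtain ⟨q, hq⟩ := exists_ultrafilter_limit hM ((hyperfilter ℕ).map i)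
  refine ⟨_, q, hq, fun hmeas => ?_⟩
  have hU : ((hyperfilter ℕ : Ultrafilter ℕ) : Filter ℕ) ≤ atTop := by
    rw [← Nat.cofinite_eq_atTop]; exact hyperfilter_le_cofinite
  let Z : Set X := {x | ∀ n, a (i n) x ≤ α ∨ β ≤ a (i n) x}
  have hZ : IsClosed Z := by
    simp only [Z, Set.ofPred_forall, Set.ofPred_or]
    exact isClosed_iInter fun n =>
      (isClosed_le (ha _) continuous_const).union (isClosed_le continuous_const (ha _))
  have : CompactSpace Z := isCompact_iff_compactSpace.1 hZ.isCompact
  classical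
  let π : Z → ℕ → ZMod 2 := fun z n => if β ≤ a (i n) z then 1 else 0
  have hπ : Measurable π := measurable_pi_iff.2 fun n =>
    Measurable.ite (measurableSet_le measurable_const ((ha _).measurable.comp measurable_subtype_coe))
      measurable_const measurable_const
  have hsurj : Function.Surjective π := by
    intro s
    obtain ⟨x, hx⟩ := hi {n | s n = 1}
    refine ⟨⟨x, fun n => ?_⟩, ?_⟩
    · by_cases h : s n = 1
      · exact Or.inr ((hx n).1 h)
      · exact Or.inl ((hx n).2 h)
    · funext n
      by_cases h : s n = 1
      · simp [π, (hx n).1 h, h]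
      · have h2 : ∀ b : ZMod 2, b ≠ 1 → 0 = b := by decide
        have : ¬ β ≤ a (i n) x := not_le.2 (((hx n).2 h).trans_lt hαβ)
        simpa [π, this] using h2 _ h
  refine not_measurableSet_setOf_eventually_eq_zero hU
    ((hπ.measurableSet_preimage_iff_of_surjective hsurj).1 ?_)
  have heq : π ⁻¹' {s | ∀ᶠ n in ((hyperfilter ℕ : Ultrafilter ℕ) : Filter ℕ), s n = 0} =
      {z : Z | q z ≤ α} := by
    ext z
    have hz : Tendsto (fun n => a (i n) z) (hyperfilter ℕ : Ultrafilter ℕ) (nhds (q z)) := hq z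
    constructor
    · intro h
      refine le_of_tendsto hz ?_
      filter_upwards [h] with n hn
      refine (z.2 n).resolve_right fun h' => ?_
      simp [π, h'] at hn
    · intro h
      filter_upwards [hz.eventually (gt_mem_nhds (lt_of_le_of_lt h hαβ))] with n hn
      simp [π, hn]
  rw [heq]
  exact measurableSet_le (hmeas.comp measurable_subtype_coe) measurable_const

theorem weak_limit_le_pointwise_limit {ι X : Type*} [MetricSpace X] [CompactSpace X]
    [MeasurableSpace X] [BorelSpace X] (ν : Measure X) [IsFiniteMeasure ν]
    {a : ι → X → ℝ} (ha : ∀ i, Continuous (a i)) {M : ℝ} (hM : ∀ i x, |a i x| ≤ M)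
    (hmeas : ∀ (G : Ultrafilter ι) (q : X → ℝ),
      (∀ x, Tendsto (fun j => a j x) G (nhds (q x))) → Measurable q)
    {F : Ultrafilter ι} {g h : X → ℝ} (hg : ∀ x, Tendsto (fun j => a j x) F (nhds (g x)))
    (hhm : Measurable h) (hhi : Integrable h ν)
    (hh : ∀ S, MeasurableSet S →
      Tendsto (fun i => ∫ x in S, a i x ∂ν) F (nhds (∫ x in S, h x ∂ν))) :
    h ≤ᵐ[ν] g := by
  by_contra hcon
  have hgm := hmeas F g hg
  obtain ⟨α, β, hαβ, hpos⟩ : ∃ α β : ℝ, α < β ∧ ν {x | g x < α ∧ β < h x} ≠ 0 := by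
    by_contra! hall
    refine hcon ?_
    have : ∀ᵐ x ∂ν, ∀ r s : ℚ, (r : ℝ) < s → ¬ (g x < r ∧ (s : ℝ) < h x) := by
      refine ae_all_iff.2 fun r => ae_all_iff.2 fun s => ?_
      by_cases hrs : (r : ℝ) < s
      · have := hall r s hrs
        simpa [ae_iff, hrs] using this
      · exact Eventually.of_forall fun x h => absurd h hrs
    filter_upwards [this] with x hx
    by_contra! hlt
    obtain ⟨r, hr1, hr2⟩ := exists_rat_btwn hlt
    obtain ⟨s, hs1, hs2⟩ := exists_rat_btwn hr2
    exact hx r s hs1 ⟨hr1, hs2⟩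
  set S : Set X := {x | g x < α ∧ β < h x}
  have hS : MeasurableSet S :=
    (measurableSet_lt hgm measurable_const).inter (measurableSet_lt measurable_const hhm)
  obtain ⟨i, hi⟩ := exists_independent_seq ha (F := F) (α := α) (β := β)
    (P := fun V => IsOpen V ∧ ν (V ∩ S) ≠ 0) ⟨isOpen_univ, by simpa using hpos⟩
    (fun V hV => (nonempty_of_measure_ne_zero hV.2).mono Set.inter_subset_left) (by
      rintro V ⟨hVo, hV⟩
      have hVS : MeasurableSet (V ∩ S) := hVo.measurableSet.inter hS
      refine Eventually.and ?_ ?_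
      · obtain ⟨x, ⟨hxV, hxS⟩, hx⟩ := (ν.restrict S).nonempty_inter_support_of_pos
          (s := V ∩ S) (by
            rw [Measure.restrict_apply hVS, Set.inter_assoc, Set.inter_self]
            exact pos_iff_ne_zero.2 hV)
        filter_upwards [(hg x).eventually (gt_mem_nhds hxS.1)] with j hj
        have hopen : IsOpen (V ∩ {x | a j x < α}) :=
          hVo.inter (isOpen_lt (ha j) continuous_const)
        refine ⟨hopen, ?_⟩
        have := (Measure.mem_support_iff_forall x).1 hx _ (hopen.mem_nhds ⟨hxV, hj⟩)
        rw [Measure.restrict_apply hopen.measurableSet] at this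
        exact this.ne'
      · have hint : β * ν.real (V ∩ S) < ∫ x in V ∩ S, h x ∂ν := by
          have : 0 < ∫ x in V ∩ S, (h x - β) ∂ν := by
            rw [setIntegral_pos_iff_support_of_nonneg_ae]
            · refine (pos_iff_ne_zero.2 hV).trans_le (measure_mono fun x hx => ⟨?_, hx⟩)
              exact (sub_pos.2 hx.2.2).ne'
            · exact (ae_restrict_mem hVS).mono fun x hx => (sub_pos.2 hx.2.2).le
            · exact (hhi.sub (integrable_const β)).integrableOn
          rw [integral_sub hhi.integrableOn (integrable_const β)] at this
          simp at this
          linarith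
        filter_upwards [(hh _ hVS).eventually (lt_mem_nhds hint)] with j hj
        refine ⟨hVo.inter (isOpen_lt continuous_const (ha j)), fun h0 => ?_⟩
        refine hj.not_ge ?_
        have hle : ∀ᵐ x ∂(ν.restrict (V ∩ S)), a j x ≤ β := by
          rw [ae_restrict_iff' hVS, ae_iff]
          refine measure_mono_null (fun x hx => ?_) h0
          simp only [Set.mem_ofPred_eq, Classical.not_imp, not_le] at hx
          exact ⟨⟨hx.1.1, hx.2⟩, hx.1.2⟩
        have hai : Integrable (a j) ν := (integrable_const M).mono'
          (ha j).measurable.aestronglyMeasurable (Eventually.of_forall (hM j))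
        calc ∫ x in V ∩ S, a j x ∂ν ≤ ∫ x in V ∩ S, β ∂ν :=
              integral_mono_ae hai.integrableOn (integrable_const β) hle
          _ = β * ν.real (V ∩ S) := by simp [mul_comm])
  obtain ⟨G, q, hq, hqm⟩ := exists_nonmeasurable_limit_of_independent ha hM hαβ hi
  exact hqm (hmeas G q hq)

theorem tendsto_integral_of_tendsto_ultrafilter {ι X : Type*} [MetricSpace X] [CompactSpace X]
    [MeasurableSpace X] [BorelSpace X] (ν : Measure X) [IsFiniteMeasure ν]
    {a : ι → X → ℝ} (ha : ∀ i, Continuous (a i)) {M : ℝ} (hM : ∀ i x, |a i x| ≤ M)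
    (hmeas : ∀ (G : Ultrafilter ι) (q : X → ℝ),
      (∀ x, Tendsto (fun j => a j x) G (nhds (q x))) → Measurable q)
    {F : Ultrafilter ι} {g : X → ℝ} (hg : ∀ x, Tendsto (fun j => a j x) F (nhds (g x))) :
    Tendsto (fun i => ∫ x, a i x ∂ν) F (nhds (∫ x, g x ∂ν)) := by
  obtain ⟨h, hhm, hhi, hh⟩ := exists_weak_limit_of_bounded ν (fun i => (ha i).measurable) hM F
  have h1 := weak_limit_le_pointwise_limit ν ha hM hmeas hg hhm hhi hh
  have h2 := weak_limit_le_pointwise_limit ν (a := fun i x => -a i x) (g := fun x => -g x)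
    (h := fun x => -h x) (F := F) (M := M) (fun i => (ha i).neg) (by simpa using hM)
    (fun G q hq => by
      have := hmeas G (fun x => -q x) fun x => by simpa using (hq x).neg
      simpa [Function.comp_def] using measurable_neg.comp this)
    (fun x => (hg x).neg) hhm.neg hhi.neg
    (fun S hS => by simpa only [integral_neg] using (hh S hS).neg)
  have heq : h =ᵐ[ν] g := by
    filter_upwards [h1, h2] with x hx1 hx2
    exact le_antisymm hx1 (neg_le_neg_iff.1 hx2)
  rw [← integral_congr_ae heq]
  simpa using hh Set.univ MeasurableSet.univ

theorem tendsto_map_of_tendsto_ultrafilter {ι X : Type*} [MetricSpace X] [CompactSpace X]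
    [MeasurableSpace X] [BorelSpace X] {T : ι → X → X} (hT : ∀ i, Continuous (T i))
    (hmeas : ∀ (G : Ultrafilter ι) (q : X → X),
      (∀ x, Tendsto (fun j => T j x) G (nhds (q x))) → Measurable q)
    {F : Ultrafilter ι} {p : X → X} (hp : ∀ x, Tendsto (fun j => T j x) F (nhds (p x)))
    (hpm : Measurable p) (ν : ProbabilityMeasure X) :
    Tendsto (fun i => ν.map (hT i).measurable.aemeasurable) F
      (nhds (ν.map hpm.aemeasurable)) := by
  rw [ProbabilityMeasure.tendsto_iff_forall_integral_tendsto]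
  intro f
  have hlim := tendsto_integral_of_tendsto_ultrafilter (ν : Measure X)
    (a := fun i x => f (T i x)) (fun i => f.continuous.comp (hT i))
    (M := ‖f‖) (fun i x => f.norm_coe_le_norm _) (fun G q hq => by
      have hex : ∀ x, ∃ y, Tendsto (fun i => T i x) G (nhds y) := fun x => by
        obtain ⟨y, -, hy⟩ := isCompact_univ.ultrafilter_le_nhds (G.map fun i => T i x) (by simp)
        exact ⟨y, hy⟩
      choose r hr using hex
      have : q = f ∘ r := funext fun x =>
        tendsto_nhds_unique (hq x) ((f.continuous.tendsto _).comp (hr x))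
      rw [this]
      exact f.continuous.measurable.comp (hmeas G r hr))
    (F := F) (g := fun x => f (p x)) (fun x => (f.continuous.tendsto _).comp (hp x))
  simp only [ProbabilityMeasure.toMeasure_map]
  rw [integral_map hpm.aemeasurable f.continuous.measurable.aestronglyMeasurable]
  refine hlim.congr fun i => ?_
  rw [integral_map (hT i).measurable.aemeasurable f.continuous.measurable.aestronglyMeasurable]

theorem mem_closure_range_iff_exists_ultrafilter {ι Y Z : Type*} [TopologicalSpace Z]
    {T : ι → Y → Z} {p : Y → Z} :
    p ∈ closure (Set.range T) ↔
      ∃ F : Ultrafilter ι, ∀ y, Tendsto (fun i => T i y) F (nhds (p y)) := by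
  simp_rw [← tendsto_pi_nhds]
  constructor
  · intro h
    have : (comap T (nhds p)).NeBot := by
      rw [comap_neBot_iff]
      intro t ht
      obtain ⟨_, h1, i, rfl⟩ := mem_closure_iff_nhds.1 h t ht
      exact ⟨i, h1⟩
    exact ⟨Ultrafilter.of _, tendsto_iff_comap.2 (Ultrafilter.of_le _)⟩
  · rintro ⟨F, hF⟩
    exact mem_closure_of_tendsto hF (Eventually.of_forall fun i => ⟨i, rfl⟩)

/-- For a tame compact metric dynamical system `(X,Γ)`, every element `p` of the
enveloping semigroup `E(X,Γ)` is Borel measurable, and the induced pushforward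
map `p_*` on probability measures gives an isomorphism (a composition-preserving
bijection) of `E(X,Γ)` onto the enveloping semigroup `E(M(X),Γ)` of the induced
action on probability measures. -/
theorem tame_enveloping_semigroup_iso {Γ X : Type*} [Group Γ]
    [MetricSpace X] [CompactSpace X] [MeasurableSpace X] [BorelSpace X]
    [MulAction Γ X]
    (hX : ∀ γ : Γ, Continuous fun x : X => γ • x)
    (E : Set (X → X))
    (hE : E = closure (Set.range fun γ : Γ => fun x : X => γ • x))
    (htame : ∀ p ∈ E, ∃ γ : ℕ → Γ, ∀ x : X,
      Tendsto (fun n => γ n • x) atTop (nhds (p x)))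
    (EM : Set (ProbabilityMeasure X → ProbabilityMeasure X))
    (hEM : EM = closure (Set.range fun γ : Γ =>
      fun ν : ProbabilityMeasure X => ν.map (hX γ).measurable.aemeasurable)) :
    (∀ p ∈ E, Measurable p) ∧
    ∃ Φ : (X → X) → (ProbabilityMeasure X → ProbabilityMeasure X),
      (∀ (p : X → X) (hp : Measurable p),
        Φ p = fun ν : ProbabilityMeasure X => ν.map hp.aemeasurable) ∧
      Set.BijOn Φ E EM ∧
      (∀ p ∈ E, ∀ q ∈ E, Φ (p ∘ q) = Φ p ∘ Φ q) := by
  classical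
  subst hE hEM
  have hmeasE : ∀ p ∈ closure (Set.range fun γ : Γ => fun x : X => γ • x), Measurable p := by
    intro p hp
    obtain ⟨γ, hγ⟩ := htame p hp
    exact measurable_of_tendsto_metrizable (fun n => (hX (γ n)).measurable)
      (tendsto_pi_nhds.2 hγ)
  have hlim : ∀ (G : Ultrafilter Γ) (q : X → X),
      (∀ x, Tendsto (fun γ : Γ => γ • x) G (nhds (q x))) → Measurable q := fun G q hq =>
    hmeasE q (mem_closure_range_iff_exists_ultrafilter.2 ⟨G, hq⟩)
  refine ⟨hmeasE, fun p => if hp : Measurable p then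
    fun ν : ProbabilityMeasure X => ν.map hp.aemeasurable else id, fun p hp => dif_pos hp,
    ⟨?_, ?_, ?_⟩, ?_⟩
  · intro p hp
    obtain ⟨F, hF⟩ := mem_closure_range_iff_exists_ultrafilter.1 hp
    simp only [dif_pos (hmeasE p hp)]
    exact mem_closure_range_iff_exists_ultrafilter.2
      ⟨F, tendsto_map_of_tendsto_ultrafilter hX hlim hF (hmeasE p hp)⟩
  · intro p hp q hq hpq
    have hp' := hmeasE p hp
    have hq' := hmeasE q hq
    simp only [dif_pos hp', dif_pos hq'] at hpq
    funext x
    have h : (Measure.dirac x).map p = (Measure.dirac x).map q := congrArg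
      (fun μ : ProbabilityMeasure X => (μ : Measure X)) (congrFun hpq ⟨Measure.dirac x, Measure.dirac.isProbabilityMeasure⟩)
    rw [Measure.map_dirac' hp', Measure.map_dirac' hq'] at h
    exact dirac_eq_dirac_iff.1 h
  · intro Q hQ
    obtain ⟨F, hF⟩ := mem_closure_range_iff_exists_ultrafilter.1 hQ
    have hex : ∀ x : X, ∃ y, Tendsto (fun γ : Γ => γ • x) F (nhds y) := fun x => by
      obtain ⟨y, -, hy⟩ := isCompact_univ.ultrafilter_le_nhds (F.map fun γ : Γ => γ • x) (by simp)
      exact ⟨y, hy⟩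
    choose p hp using hex
    have hpm := hlim F p hp
    refine ⟨p, mem_closure_range_iff_exists_ultrafilter.2 ⟨F, hp⟩, ?_⟩
    simp only [dif_pos hpm]
    funext ν
    exact tendsto_nhds_unique (tendsto_map_of_tendsto_ultrafilter hX hlim hp hpm ν) (hF ν)
  · intro p hp q hq
    have hp' := hmeasE p hp
    have hq' := hmeasE q hq
    simp only [dif_pos hp', dif_pos hq', dif_pos (hp'.comp hq')]
    funext ν
    exact Subtype.ext (Measure.map_map hp' hq').symm
end

section
/- Let Γ be an Abelian group acting minimally by homeomorphisms on a compact metric space X, and let v be an idempotent element of the enveloping semigroup E(X,Γ) (i.e. v ∘ v = v). Then every point x ∈ X at which v : X → X is continuous satisfies v(x) = x. -/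
open Filter

/-- Every element of the enveloping semigroup of an action of an Abelian group by continuous maps
commutes with the action. -/
theorem map_smul_of_mem_closure_range_smul {Γ X : Type*}
    [CommGroup Γ] [TopologicalSpace X] [T2Space X] [MulAction Γ X]
    (hX : ∀ γ : Γ, Continuous fun x : X => γ • x) {v : X → X}
    (hvE : v ∈ closure (Set.range fun γ : Γ => fun x : X => γ • x)) (γ : Γ) (x : X) :
    v (γ • x) = γ • v x := by
  have hclosed : IsClosed {f : X → X | f (γ • x) = γ • f x} :=
    isClosed_eq (continuous_apply _) ((hX γ).comp (continuous_apply x))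
  refine closure_minimal ?_ hclosed hvE
  rintro _ ⟨δ, rfl⟩
  exact smul_comm δ γ x

/-- Let an Abelian group `Γ` act minimally by homeomorphisms on a compact
metric space `X`, and let `v` be an idempotent element of the enveloping
semigroup `E(X,Γ)`. Then `v` fixes each of its continuity points. -/
theorem idempotent_in_enveloping_fixes_continuity_points {Γ X : Type*}
    [CommGroup Γ] [MetricSpace X] [CompactSpace X] [MulAction Γ X]
    (hX : ∀ γ : Γ, Continuous fun x : X => γ • x)
    (hmin : ∀ x : X, Dense (MulAction.orbit Γ x))
    (v : X → X)
    (hvE : v ∈ closure (Set.range fun γ : Γ => fun x : X => γ • x))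
    (hv : v ∘ v = v) :
    ∀ x : X, ContinuousAt v x → v x = x := by
  intro x hx
  have hne : (nhdsWithin x (MulAction.orbit Γ (v x))).NeBot :=
    mem_closure_iff_nhdsWithin_neBot.mp (hmin (v x) x)
  have hfix : Set.EqOn v id (MulAction.orbit Γ (v x)) := by
    rintro _ ⟨γ, rfl⟩
    simpa [map_smul_of_mem_closure_range_smul hX hvE] using congrArg (γ • ·) (congrFun hv x)
  have hid : Tendsto v (nhdsWithin x (MulAction.orbit Γ (v x))) (nhds x) :=
    (tendsto_id.mono_left nhdsWithin_le_nhds).congr'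
      (eventually_nhdsWithin_of_forall fun y hy => (hfix hy).symm)
  exact tendsto_nhds_unique (hx.mono_left nhdsWithin_le_nhds) hid
end
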